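/- (Stanley's nonnegativity theorem) Let S ⊆ ℤ^n be a finite nonempty set, let P = conv(S), and let d be the dimension of the affine hull of P. Then there exist nonnegative integers h*_0, h*_1, …, h*_d such that for every positive integer k, #(ℤ^n ∩ k·P) = Σ_{i=0}^{d} h*_i · C(k+d−i, d). -/

import Mathlib

open scoped Pointwise

/-- A basis of `E` selected from the family `v`, recorded by the set of selected indices and by
the coordinate map, extended by zero to all indices. -/
structure SubfamilyBasis {ι E : Type*} [Fintype ι] [DecidableEq ι] [AddCommGroup E] [Module ℝ E]
    (v : ι → E) where
  support : Finset ι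
  coord : E →ₗ[ℝ] ι → ℝ
  coord_of_notMem : ∀ x, ∀ s ∉ support, coord x s = 0
  sum_coord : ∀ x, ∑ s, coord x s • v s = x
  coord_self : ∀ s ∈ support, coord (v s) = Pi.single s 1

namespace SubfamilyBasis

variable {ι E : Type*} [Fintype ι] [DecidableEq ι] [AddCommGroup E] [Module ℝ E] {v : ι → E}

theorem coord_sum_smul (b : SubfamilyBasis v) {a : ι → ℝ} (ha : ∀ s ∉ b.support, a s = 0) :
    b.coord (∑ s, a s • v s) = a := by
  rw [map_sum]
  ext t
  simp only [map_smul, Finset.sum_apply, Pi.smul_apply, smul_eq_mul]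
  rw [Finset.sum_eq_single t]
  · by_cases ht : t ∈ b.support
    · simp [b.coord_self t ht]
    · simp [ha t ht]
  · intro s _ hst
    by_cases hs : s ∈ b.support
    · simp [b.coord_self s hs, hst.symm]
    · simp [ha s hs]
  · simp

theorem support_injective :
    Function.Injective (support : SubfamilyBasis v → Finset ι) := by
  intro b b' h
  have hc : b.coord = b'.coord := by
    ext1 x
    have := b.coord_sum_smul (a := b'.coord x) fun s hs => b'.coord_of_notMem x s (h ▸ hs)
    rwa [b'.sum_coord] at this
  cases b
  cases b'
  cases h
  cases hc
  rfl

instance : Finite (SubfamilyBasis v) := Finite.of_injective _ support_injective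

/-- Every set of indices `A` admits a basis that contains a maximal independent subset of `A`. -/
theorem exists_adapted (hv : Submodule.span ℝ (Set.range v) = ⊤) (A : Set ι) :
    ∃ b : SubfamilyBasis v, ∀ t ∈ A, ∀ s ∈ b.support, s ∉ A → b.coord (v t) s = 0 := by
  obtain ⟨σ₀, h₀A, -, hA, hli₀⟩ :=
    exists_linearIndepOn_extension (linearIndepOn_empty ℝ v) (Set.empty_subset A)
  obtain ⟨σ, -, h₀σ, hσ, hli⟩ := exists_linearIndepOn_extension hli₀ (Set.subset_univ σ₀)
  classical
  have htop : ⊤ ≤ Submodule.span ℝ (Set.range fun s : σ => v s) := by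
    rw [← hv, Submodule.span_le]
    rw [Set.image_univ] at hσ
    rwa [← Set.image_eq_range]
  let B := Module.Basis.mk hli htop
  have hB : ∀ s : σ, B s = v s := fun s => Module.Basis.mk_apply hli htop s
  let c : E →ₗ[ℝ] ι → ℝ :=
    LinearMap.pi fun s => if h : s ∈ σ then B.coord ⟨s, h⟩ else 0
  have hc : ∀ x s (h : s ∈ σ), c x s = B.repr x ⟨s, h⟩ := fun x s h => by simp [c, h]
  have hc0 : ∀ x s, s ∉ σ → c x s = 0 := fun x s h => by simp [c, h]
  have hcv : ∀ s ∈ σ, c (v s) = Pi.single s 1 := by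
    intro s hs
    ext t
    by_cases ht : t ∈ σ
    · rw [hc _ _ ht, ← hB ⟨s, hs⟩, B.repr_self, Finsupp.single_apply, Pi.single_apply]
      simp [eq_comm]
    · rw [hc0 _ _ ht, Pi.single_eq_of_ne]
      rintro rfl
      exact ht hs
  refine ⟨⟨σ.toFinset, c, ?_, ?_, ?_⟩, ?_⟩
  · simpa using hc0
  · intro x
    conv_rhs => rw [← B.sum_repr x]
    rw [← Finset.sum_subset (Finset.subset_univ σ.toFinset)]
    · rw [← Finset.sum_coe_sort]
      refine Fintype.sum_equiv (Equiv.subtypeEquivRight (by simp)) _ _ ?_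
      rintro ⟨s, hs⟩
      rw [Set.mem_toFinset] at hs
      rw [hc _ _ hs, hB]
      rfl
    · intro s _ hs
      rw [hc0 x s (by simpa using hs), zero_smul]
  · simpa using hcv
  · intro t ht s _ hsA
    have hmem : v t ∈ Submodule.span ℝ (v '' σ₀) := hA ⟨t, ht, rfl⟩
    change c (v t) s = 0
    have hle : Submodule.span ℝ (v '' σ₀) ≤ LinearMap.ker ((LinearMap.proj s).comp c) := by
      rw [Submodule.span_le]
      rintro _ ⟨r, hr, rfl⟩
      have : s ≠ r := fun h => hsA (h ▸ h₀A hr)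
      simp [hcv r (h₀σ hr), this]
    exact hle hmem

theorem card_support (b : SubfamilyBasis v) : b.support.card = Module.finrank ℝ E := by
  have hli : LinearIndependent ℝ fun s : b.support => v s := by
    rw [Fintype.linearIndependent_iff]
    intro g hg s
    let a : ι → ℝ := fun t => if h : t ∈ b.support then g ⟨t, h⟩ else 0
    have ha : ∑ t, a t • v t = 0 := by
      rw [← hg, ← Finset.sum_subset (Finset.subset_univ b.support), ← Finset.sum_coe_sort]
      · exact Finset.sum_congr rfl fun t _ => by simp [a]
      · intro t _ ht
        simp [a, ht]
    have := b.coord_sum_smul (a := a) fun t ht => by simp [a, ht]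
    rw [ha, map_zero] at this
    simpa [a] using (congrFun this s).symm
  have hspan : ⊤ ≤ Submodule.span ℝ (Set.range fun s : b.support => v s) := by
    intro x _
    rw [← b.sum_coord x]
    refine Submodule.sum_mem _ fun s _ => ?_
    by_cases hs : s ∈ b.support
    · exact Submodule.smul_mem _ _ (Submodule.subset_span ⟨⟨s, hs⟩, rfl⟩)
    · simp [b.coord_of_notMem x s hs]
  rw [Module.finrank_eq_card_basis (Module.Basis.mk hli hspan), Fintype.card_coe]

end SubfamilyBasis

/-- Some point of the moment curve with positive parameter avoids finitely many hyperplanes. -/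
theorem exists_pos_forall_sum_mul_ne_zero {ι κ : Type*} [Fintype ι] [Finite κ]
    (f : κ → ι → ℝ) (hf : ∀ j, f j ≠ 0) :
    ∃ w : ι → ℝ, (∀ i, 0 < w i) ∧ ∀ j, ∑ i, f j i * w i ≠ 0 := by
  classical
  let e := Fintype.equivFin ι
  let p : κ → Polynomial ℝ := fun j => ∑ i, Polynomial.C (f j i) * Polynomial.X ^ (e i : ℕ)
  have hp : ∀ j, p j ≠ 0 := by
    intro j hj
    refine hf j (funext fun i => ?_)
    have := congrArg (fun q => q.coeff (e i : ℕ)) hj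
    simpa [p, Polynomial.finsetSum_coeff, Polynomial.coeff_C_mul, Polynomial.coeff_X_pow,
      Fin.val_inj] using this
  have hfin : (⋃ j, {t : ℝ | (p j).IsRoot t}).Finite :=
    Set.finite_iUnion fun j => Polynomial.finite_setOfPred_isRoot (hp j)
  obtain ⟨t, ht, htp⟩ := (Set.Ioi_infinite (0 : ℝ)).exists_notMem_finite hfin
  refine ⟨fun i => t ^ (e i : ℕ), fun i => pow_pos ht _, fun j hj => htp ?_⟩
  refine Set.mem_iUnion.2 ⟨j, ?_⟩
  simpa [p, Polynomial.IsRoot, Polynomial.eval_finsetSum] using hj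

theorem Finset.card_piAntidiag_of_card_eq_succ {ι : Type*} [DecidableEq ι] {s : Finset ι} {d : ℕ}
    (hs : s.card = d + 1) (k : ℕ) : (s.piAntidiag k).card = (k + d).choose d := by
  have h : (s.piAntidiag k).card = (s.finsuppAntidiag k).card := by
    symm
    refine Finset.card_bij (fun f _ => ⇑f) ?_ (fun _ _ _ _ h => DFunLike.coe_injective h) ?_
    · intro f hf
      rw [Finset.mem_finsuppAntidiag] at hf
      rw [Finset.mem_piAntidiag]
      exact ⟨hf.1, fun i hi => hf.2 (Finsupp.mem_support_iff.2 hi)⟩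
    · intro f hf
      rw [Finset.mem_piAntidiag] at hf
      refine ⟨Finsupp.onFinset s f hf.2, ?_, rfl⟩
      rw [Finset.mem_finsuppAntidiag]
      exact ⟨hf.1, Finsupp.support_onFinset_subset⟩
  rw [h, Finset.card_finsuppAntidiag_nat_eq_choose, hs, show d + 1 + k - 1 = k + d by omega,
    Nat.choose_symm_add]

/-- `f k` is a nonnegative integer combination of the binomials `C(k + d - i, d)`, `0 ≤ i ≤ d`. -/
def HasNonnegHStar (d : ℕ) (f : ℕ → ℕ) : Prop :=
  ∃ h : Fin (d + 1) → ℕ, ∀ k, f k = ∑ i : Fin (d + 1), h i * (k + d - i).choose d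

theorem HasNonnegHStar.sum {d : ℕ} {α : Type*} {s : Finset α} {f : α → ℕ → ℕ}
    (hf : ∀ a ∈ s, HasNonnegHStar d (f a)) : HasNonnegHStar d fun k => ∑ a ∈ s, f a k := by
  choose! h hh using hf
  refine ⟨fun i => ∑ a ∈ s, h a i, fun k => ?_⟩
  beta_reduce
  rw [Finset.sum_congr rfl fun a ha => hh a ha k, Finset.sum_comm]
  exact Finset.sum_congr rfl fun i _ => (Finset.sum_mul _ _ _).symm

theorem hasNonnegHStar_choose {d i : ℕ} (hi : i ≤ d) :
    HasNonnegHStar d fun k => (k + d - i).choose d := by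
  refine ⟨Pi.single ⟨i, by omega⟩ 1, fun k => ?_⟩
  rw [Finset.sum_eq_single ⟨i, by omega⟩]
  · simp
  · intro j _ hj
    simp [hj]
  · simp

namespace SubfamilyBasis

variable {ι E : Type*} [Fintype ι] [DecidableEq ι] [AddCommGroup E] [Module ℝ E] {v : ι → E}

/-- The half-open cone spanned by `b`, with the facet opposite to `s` included iff `J s`. -/
def halfOpenCone (b : SubfamilyBasis v) (J : ι → Prop) : Set E :=
  {x | ∀ s ∈ b.support, 0 < b.coord x s ∨ (b.coord x s = 0 ∧ J s)}

/-- The half-open fundamental parallelepiped of `halfOpenCone b J`. -/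
def halfOpenBox (b : SubfamilyBasis v) (J : ι → Prop) : Set E :=
  {x ∈ b.halfOpenCone J | ∀ s ∈ b.support, b.coord x s ≤ 1 ∧ (J s → b.coord x s < 1)}

theorem coord_add_sum_smul (b : SubfamilyBasis v) (x : E) {m : ι → ℕ}
    (hm : ∀ s ∉ b.support, m s = 0) (s : ι) :
    b.coord (x + ∑ t, m t • v t) s = b.coord x s + m s := by
  have := b.coord_sum_smul (a := fun t => (m t : ℝ)) fun t ht => by simp [hm t ht]
  simp only [Nat.cast_smul_eq_nsmul] at this
  rw [map_add, this, Pi.add_apply]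

theorem ext_coord (b : SubfamilyBasis v) {x y : E} (h : ∀ s, b.coord x s = b.coord y s) :
    x = y := by
  rw [← b.sum_coord x, ← b.sum_coord y]
  simp [h]

theorem exists_halfOpenBox_add (b : SubfamilyBasis v) {J : ι → Prop} {x : E}
    (hx : x ∈ b.halfOpenCone J) :
    ∃ p ∈ b.halfOpenBox J, ∃ m : ι → ℕ, (∀ s ∉ b.support, m s = 0) ∧
      p + ∑ s, m s • v s = x := by
  have key : ∀ s, ∃ m : ℕ, (s ∉ b.support → m = 0) ∧ (s ∈ b.support →
      (0 < b.coord x s - m ∨ (b.coord x s - m = 0 ∧ J s)) ∧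
      b.coord x s - m ≤ 1 ∧ (J s → b.coord x s - m < 1)) := by
    intro s
    by_cases hs : s ∈ b.support
    swap
    · exact ⟨0, fun _ => rfl, fun h => (hs h).elim⟩
    by_cases hJ : J s
    · have h0 : 0 ≤ b.coord x s := by
        rcases hx s hs with h | h
        · exact h.le
        · exact h.1.ge
      refine ⟨⌊b.coord x s⌋₊, fun h => (h hs).elim, fun _ => ?_⟩
      have h1 := Nat.floor_le h0
      have h2 := Nat.lt_floor_add_one (b.coord x s)
      refine ⟨?_, by linarith, fun _ => by linarith⟩
      rcases h1.lt_or_eq with h | h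
      · exact Or.inl (by linarith)
      · exact Or.inr ⟨by linarith, hJ⟩
    · have h0 : 0 < b.coord x s := by
        rcases hx s hs with h | h
        · exact h
        · exact (hJ h.2).elim
      refine ⟨⌈b.coord x s⌉₊ - 1, fun h => (h hs).elim, fun _ => ?_⟩
      have hc : 0 < ⌈b.coord x s⌉₊ := Nat.ceil_pos.2 h0
      have h1 := Nat.le_ceil (b.coord x s)
      have h2 := Nat.ceil_lt_add_one h0.le
      rw [Nat.cast_pred hc]
      exact ⟨Or.inl (by linarith), by linarith, fun h => (hJ h).elim⟩
  choose m hm0 hm using key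
  have hc : ∀ s, b.coord (x - ∑ t, m t • v t) s = b.coord x s - m s := by
    intro s
    have := b.coord_add_sum_smul (x - ∑ t, m t • v t) hm0 s
    rw [sub_add_cancel] at this
    linarith
  refine ⟨x - ∑ t, m t • v t, ⟨fun s hs => ?_, fun s hs => ?_⟩, m, hm0, sub_add_cancel _ _⟩
  · rw [hc]
    exact (hm s hs).1
  · rw [hc]
    exact (hm s hs).2

theorem add_mem_halfOpenCone (b : SubfamilyBasis v) {J : ι → Prop} {p : E}
    (hp : p ∈ b.halfOpenCone J) {m : ι → ℕ} (hm : ∀ s ∉ b.support, m s = 0) :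
    p + ∑ s, m s • v s ∈ b.halfOpenCone J := by
  intro s hs
  rw [b.coord_add_sum_smul p hm]
  rcases hp s hs with h | h
  · exact Or.inl (by positivity)
  · rcases (m s).eq_zero_or_pos with h0 | h0
    · exact Or.inr ⟨by simp [h.1, h0], h.2⟩
    · left
      have : (0 : ℝ) < m s := by exact_mod_cast h0
      linarith [h.1]

theorem halfOpenBox_add_injective (b : SubfamilyBasis v) {J : ι → Prop} {p q : E} {m n : ι → ℕ}
    (hp : p ∈ b.halfOpenBox J) (hq : q ∈ b.halfOpenBox J) (hm : ∀ s ∉ b.support, m s = 0)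
    (hn : ∀ s ∉ b.support, n s = 0) (h : p + ∑ s, m s • v s = q + ∑ s, n s • v s) :
    p = q ∧ m = n := by
  have hc : ∀ s, b.coord p s + m s = b.coord q s + n s := fun s => by
    rw [← b.coord_add_sum_smul p hm, h, b.coord_add_sum_smul q hn]
  have hmn : m = n := by
    ext s
    by_cases hs : s ∈ b.support
    swap
    · rw [hm s hs, hn s hs]
    have hlt : ∀ {x y : E}, x ∈ b.halfOpenBox J → y ∈ b.halfOpenBox J →
        b.coord x s - b.coord y s < 1 := by
      intro x y hx hy
      have h1 := hx.2 s hs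
      rcases hy.1 s hs with h2 | h2
      · linarith
      · linarith [h1.2 h2.2]
    have h1 := hlt hp hq
    have h2 := hlt hq hp
    have h3 : (n s : ℝ) < m s + 1 := by linarith [hc s]
    have h4 : (m s : ℝ) < n s + 1 := by linarith [hc s]
    norm_cast at h3 h4
    omega
  refine ⟨b.ext_coord fun s => ?_, hmn⟩
  have := hc s
  rw [hmn] at this
  linarith

theorem height_eq_sum_coord (b : SubfamilyBasis v) {ht : E →ₗ[ℝ] ℝ} (hv : ∀ s, ht (v s) = 1)
    (x : E) : ht x = ∑ s ∈ b.support, b.coord x s := by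
  conv_lhs => rw [← b.sum_coord x]
  rw [map_sum, ← Finset.sum_subset (Finset.subset_univ b.support)]
  · simp [hv]
  · intro s _ hs
    simp [b.coord_of_notMem x s hs]

theorem height_nonneg_of_mem_halfOpenCone (b : SubfamilyBasis v) {ht : E →ₗ[ℝ] ℝ}
    (hv : ∀ s, ht (v s) = 1) {J : ι → Prop} {x : E} (hx : x ∈ b.halfOpenCone J) : 0 ≤ ht x := by
  rw [b.height_eq_sum_coord hv]
  refine Finset.sum_nonneg fun s hs => ?_
  rcases hx s hs with h | h
  · exact h.le
  · exact h.1.ge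

theorem height_lt_of_mem_halfOpenBox (b : SubfamilyBasis v) {ht : E →ₗ[ℝ] ℝ}
    (hv : ∀ s, ht (v s) = 1) {J : ι → Prop} (hJ : ∃ s ∈ b.support, J s) {x : E}
    (hx : x ∈ b.halfOpenBox J) : ht x < b.support.card := by
  rw [b.height_eq_sum_coord hv, Finset.card_eq_sum_ones, Nat.cast_sum]
  obtain ⟨s, hs, hJs⟩ := hJ
  refine Finset.sum_lt_sum (fun t ht => ?_) ⟨s, hs, ?_⟩
  · simpa using (hx.2 t ht).1
  · simpa using (hx.2 s hs).2 hJs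

/-- Lattice points of a half-open simplicial cone, counted by height. -/
theorem hasNonnegHStar_halfOpenCone (b : SubfamilyBasis v) {d : ℕ} (hd : b.support.card = d + 1)
    {ht : E →ₗ[ℝ] ℝ} (hv : ∀ s, ht (v s) = 1) {J : ι → Prop} (hJ : ∃ s ∈ b.support, J s)
    {L : AddSubgroup E} (hvL : ∀ s, v s ∈ L) (hint : ∀ x ∈ L, ∃ z : ℤ, ht x = z)
    (hfin : ∀ k : ℕ, {x | x ∈ L ∧ x ∈ b.halfOpenCone J ∧ ht x = k}.Finite) :
    HasNonnegHStar d fun k => {x | x ∈ L ∧ x ∈ b.halfOpenCone J ∧ ht x = k}.ncard := by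
  classical
  have hnat : ∀ x, ∃ n : ℕ, x ∈ L → x ∈ b.halfOpenCone J → ht x = n := by
    intro x
    by_cases hx : x ∈ L ∧ x ∈ b.halfOpenCone J
    · obtain ⟨z, hz⟩ := hint x hx.1
      have h0 := b.height_nonneg_of_mem_halfOpenCone hv hx.2
      rw [hz] at h0
      lift z to ℕ using by exact_mod_cast h0
      exact ⟨z, fun _ _ => by simpa using hz⟩
    · exact ⟨0, fun h h' => (hx ⟨h, h'⟩).elim⟩
  choose N hN using hnat
  have hNd : ∀ x ∈ L, x ∈ b.halfOpenBox J → N x ≤ d := by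
    intro x hxL hx
    have := b.height_lt_of_mem_halfOpenBox hv hJ hx
    rw [hN x hxL hx.1, hd] at this
    norm_cast at this
    omega
  have hbox : {x | x ∈ L ∧ x ∈ b.halfOpenBox J}.Finite := by
    refine (Set.finite_iUnion fun k : Fin (d + 1) => hfin k).subset ?_
    rintro x ⟨hxL, hx⟩
    exact Set.mem_iUnion.2 ⟨⟨N x, by have := hNd x hxL hx; omega⟩, hxL, hx.1, hN x hxL hx.1⟩
  have hcount : ∀ k : ℕ, {x | x ∈ L ∧ x ∈ b.halfOpenCone J ∧ ht x = k}.ncard =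
      ∑ p ∈ hbox.toFinset, (k + d - N p).choose d := by
    intro k
    let F : E → Finset (ι → ℕ) := fun p =>
      if N p ≤ k then b.support.piAntidiag (k - N p) else ∅
    have hF : ∀ p m, m ∈ F p ↔ N p + ∑ s ∈ b.support, m s = k ∧ ∀ s ∉ b.support, m s = 0 := by
      intro p m
      by_cases h : N p ≤ k
      · simp only [F, if_pos h, Finset.mem_piAntidiag, ne_eq]
        refine and_congr ?_ (forall_congr' fun s => not_imp_comm)
        change ∑ s ∈ b.support, m s = k - N p ↔ _
        omega
      · simp only [F, if_neg h, Finset.notMem_empty, false_iff]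
        omega
    have hFcard : ∀ p ∈ hbox.toFinset, (F p).card = (k + d - N p).choose d := by
      intro p hp
      by_cases h : N p ≤ k
      · simp only [F, if_pos h]
        rw [Finset.card_piAntidiag_of_card_eq_succ hd, Nat.sub_add_comm h]
      · simp only [F, if_neg h, Finset.card_empty]
        rw [Nat.choose_eq_zero_of_lt]
        have := hNd p (hbox.mem_toFinset.1 hp).1 (hbox.mem_toFinset.1 hp).2
        omega
    have hht : ∀ (p : E) (m : ι → ℕ), (∀ s ∉ b.support, m s = 0) →
        ht (p + ∑ s, m s • v s) = ht p + ((∑ s ∈ b.support, m s : ℕ) : ℝ) := by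
      intro p m hm
      rw [Finset.sum_subset (Finset.subset_univ b.support) fun s _ hs => hm s hs]
      simp [hv]
    rw [← Finset.sum_congr rfl hFcard, ← Finset.card_sigma, Set.ncard_eq_toFinset_card _ (hfin k)]
    symm
    refine Finset.card_bij (fun a _ => a.1 + ∑ s, a.2 s • v s) ?_ ?_ ?_
    · rintro ⟨p, m⟩ h
      simp only [Finset.mem_sigma, Set.Finite.mem_toFinset, Set.mem_ofPred_eq, hF] at h ⊢
      obtain ⟨⟨hpL, hp⟩, hk, hm⟩ := h
      refine ⟨L.add_mem hpL (L.sum_mem fun s _ => L.nsmul_mem (hvL s) _),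
        b.add_mem_halfOpenCone hp.1 hm, ?_⟩
      rw [hht p m hm, hN p hpL hp.1]
      exact_mod_cast hk
    · rintro ⟨p, m⟩ h ⟨q, n⟩ h' heq
      simp only [Finset.mem_sigma, Set.Finite.mem_toFinset, Set.mem_ofPred_eq, hF] at h h'
      obtain ⟨rfl, rfl⟩ := b.halfOpenBox_add_injective h.1.2 h'.1.2 h.2.2 h'.2.2 heq
      rfl
    · intro x hx
      simp only [Set.Finite.mem_toFinset, Set.mem_ofPred_eq] at hx
      obtain ⟨hxL, hx, hxk⟩ := hx
      obtain ⟨p, hp, m, hm, rfl⟩ := b.exists_halfOpenBox_add hx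
      have hpL : p ∈ L := by
        have := L.sub_mem hxL (L.sum_mem fun s (_ : s ∈ Finset.univ) => L.nsmul_mem (hvL s) (m s))
        rwa [add_sub_cancel_right] at this
      refine ⟨⟨p, m⟩, ?_, rfl⟩
      simp only [Finset.mem_sigma, Set.Finite.mem_toFinset, Set.mem_ofPred_eq, hF]
      refine ⟨⟨hpL, hp⟩, ?_, hm⟩
      rw [hht p m hm, hN p hpL hp.1] at hxk
      exact_mod_cast hxk
  simp only [hcount]
  exact HasNonnegHStar.sum fun p hp => hasNonnegHStar_choose
    (hNd p (hbox.mem_toFinset.1 hp).1 (hbox.mem_toFinset.1 hp).2)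

end SubfamilyBasis

/-- The convex cone generated by the family `v`. -/
def generatedCone {ι E : Type*} [Fintype ι] [AddCommGroup E] [Module ℝ E] (v : ι → E) : Set E :=
  {x | ∃ w : ι → ℝ, (∀ s, 0 ≤ w s) ∧ ∑ s, w s • v s = x}

/-- A linear cost function attains its minimum on the nonnegative representations of `x`. -/
theorem exists_min_cost {ι E : Type*} [Fintype ι] [NormedAddCommGroup E] [NormedSpace ℝ E]
    {v : ι → E} {ht : E →ₗ[ℝ] ℝ} (hv : ∀ s, ht (v s) = 1) (ω : ι → ℝ) {x : E}
    (hx : x ∈ generatedCone v) :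
    ∃ w : ι → ℝ, (∀ s, 0 ≤ w s) ∧ ∑ s, w s • v s = x ∧
      ∀ w' : ι → ℝ, (∀ s, 0 ≤ w' s) → ∑ s, w' s • v s = x →
        ∑ s, w s * ω s ≤ ∑ s, w' s * ω s := by
  let K : Set (ι → ℝ) := {w | (∀ s, 0 ≤ w s) ∧ ∑ s, w s • v s = x}
  have hclosed : IsClosed K := by
    refine IsClosed.inter ?_ ?_
    · exact isClosed_le continuous_const continuous_id
    · exact isClosed_eq (by fun_prop) continuous_const
  have hsub : K ⊆ Set.Icc 0 (fun _ => ht x) := by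
    rintro w ⟨h0, hw⟩
    refine ⟨h0, fun s => ?_⟩
    have : ht x = ∑ s, w s := by simp [← hw, hv]
    rw [this]
    exact Finset.single_le_sum (fun t _ => h0 t) (Finset.mem_univ s)
  have hK : IsCompact K := isCompact_Icc.of_isClosed_subset hclosed hsub
  obtain ⟨w, hw, hmin⟩ := hK.exists_isMinOn (f := fun w => ∑ s, w s * ω s) hx (by fun_prop)
  exact ⟨w, hw.1, hw.2, fun w' h0 h1 => hmin ⟨h0, h1⟩⟩

/-- Feasible directions at a representation of minimal cost do not decrease the cost. -/
theorem cost_nonneg_of_feasible_direction {ι E : Type*} [Fintype ι] [AddCommGroup E] [Module ℝ E]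
    {v : ι → E} {ω w : ι → ℝ} (h0 : ∀ s, 0 ≤ w s)
    (hmin : ∀ w' : ι → ℝ, (∀ s, 0 ≤ w' s) → ∑ s, w' s • v s = ∑ s, w s • v s →
      ∑ s, w s * ω s ≤ ∑ s, w' s * ω s)
    {a : ι → ℝ} (ha : ∑ s, a s • v s = 0) (haw : ∀ s, a s < 0 → 0 < w s) :
    0 ≤ ∑ s, a s * ω s := by
  have hev : ∀ᶠ ε in nhdsWithin (0 : ℝ) (Set.Ioi 0), ∀ s, 0 ≤ w s + ε * a s := by
    rw [Filter.eventually_all]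
    intro s
    rcases le_or_gt 0 (a s) with h | h
    · filter_upwards [self_mem_nhdsWithin] with ε hε
      exact add_nonneg (h0 s) (mul_nonneg (le_of_lt hε) h)
    · have hcont : Continuous fun ε : ℝ => w s + ε * a s := by fun_prop
      have := hcont.tendsto 0
      simp only [zero_mul, add_zero] at this
      exact (this.mono_left nhdsWithin_le_nhds).eventually (Ici_mem_nhds (haw s h))
  obtain ⟨ε, hε, hpos⟩ := (hev.and self_mem_nhdsWithin).exists
  have := hmin (fun s => w s + ε * a s) hε (by
    simp [add_smul, mul_smul, Finset.sum_add_distrib, ← Finset.smul_sum, ha])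
  simp only [add_mul, mul_assoc, Finset.sum_add_distrib, ← Finset.mul_sum] at this
  exact nonneg_of_mul_nonneg_right (by linarith) hpos

namespace SubfamilyBasis

section Triangulation

variable {ι E : Type*} [Fintype ι] [DecidableEq ι] [AddCommGroup E] [Module ℝ E] {v : ι → E}

/-- The cells of the regular triangulation induced by the heights `ω`: the linear function that
agrees with `ω` on the basis lies strictly below `ω` elsewhere. -/
def IsRegularCell (ω : ι → ℝ) (b : SubfamilyBasis v) : Prop :=
  ∀ t ∉ b.support, ∑ s, b.coord (v t) s * ω s < ω t

theorem sum_sub_coord_smul (b : SubfamilyBasis v) (t : ι) :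
    ∑ s, ((Pi.single t 1 : ι → ℝ) s - b.coord (v t) s) • v s = 0 := by
  simp [sub_smul, Finset.sum_sub_distrib, b.sum_coord, Pi.single_apply]

theorem IsRegularCell.cost_le {ω : ι → ℝ} {b b' : SubfamilyBasis v} (hb : b.IsRegularCell ω)
    {x : E} (hx : ∀ s ∈ b'.support, 0 < b'.coord x s) :
    ∑ s, b.coord x s * ω s ≤ ∑ s, b'.coord x s * ω s ∧
      (¬ b'.support ⊆ b.support → ∑ s, b.coord x s * ω s < ∑ s, b'.coord x s * ω s) := by
  have h0 : ∀ t, 0 ≤ b'.coord x t := fun t => by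
    by_cases ht : t ∈ b'.support
    · exact (hx t ht).le
    · exact (b'.coord_of_notMem x t ht).ge
  have hle : ∀ t, ∑ s, b.coord (v t) s * ω s ≤ ω t := fun t => by
    by_cases ht : t ∈ b.support
    · simp [b.coord_self t ht, Pi.single_apply]
    · exact (hb t ht).le
  have hcost : ∑ s, b.coord x s * ω s =
      ∑ t, b'.coord x t * ∑ s, b.coord (v t) s * ω s := by
    conv_lhs => rw [← b'.sum_coord x]
    simp only [map_sum, map_smul, Finset.sum_apply, Pi.smul_apply, smul_eq_mul, Finset.sum_mul,
      Finset.mul_sum, mul_assoc]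
    exact Finset.sum_comm
  rw [hcost]
  refine ⟨Finset.sum_le_sum fun t _ => mul_le_mul_of_nonneg_left (hle t) (h0 t), fun h => ?_⟩
  obtain ⟨t, ht', ht⟩ := Finset.not_subset.1 h
  exact Finset.sum_lt_sum (fun t _ => mul_le_mul_of_nonneg_left (hle t) (h0 t))
    ⟨t, Finset.mem_univ t, mul_lt_mul_of_pos_left (hb t ht) (hx t ht')⟩

theorem IsRegularCell.eq_of_coord_pos {ω : ι → ℝ} {b b' : SubfamilyBasis v}
    (hb : b.IsRegularCell ω) (hb' : b'.IsRegularCell ω) {x : E}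
    (hx : ∀ s ∈ b.support, 0 < b.coord x s) (hx' : ∀ s ∈ b'.support, 0 < b'.coord x s) :
    b = b' := by
  have h := hb.cost_le hx'
  have h' := hb'.cost_le hx
  refine support_injective (Finset.Subset.antisymm ?_ ?_)
  · by_contra hn
    exact absurd (h'.2 hn) h.1.not_gt
  · by_contra hn
    exact absurd (h.2 hn) h'.1.not_gt

/-- For small `ε > 0` the coordinates of `x + ε q` have the signs prescribed by those of `x`, with
ties broken by `q`. -/
theorem exists_pos_forall_coord_add_smul {q : E}
    (hq : ∀ b : SubfamilyBasis v, ∀ s ∈ b.support, b.coord q s ≠ 0) (x : E) :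
    ∃ ε : ℝ, 0 < ε ∧ ∀ b : SubfamilyBasis v, ∀ s ∈ b.support, b.coord (x + ε • q) s ≠ 0 ∧
      (0 < b.coord (x + ε • q) s ↔ 0 < b.coord x s ∨ (b.coord x s = 0 ∧ 0 < b.coord q s)) := by
  have hev : ∀ᶠ ε in nhdsWithin (0 : ℝ) (Set.Ioi 0), ∀ b : SubfamilyBasis v, ∀ s : b.support,
      b.coord (x + ε • q) s ≠ 0 ∧ (0 < b.coord (x + ε • q) s ↔
        0 < b.coord x s ∨ (b.coord x s = 0 ∧ 0 < b.coord q s)) := by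
    simp only [Filter.eventually_all]
    rintro b ⟨s, hs⟩
    simp only [map_add, map_smul, Pi.add_apply, Pi.smul_apply, smul_eq_mul]
    have hcont : Continuous fun ε : ℝ => b.coord x s + ε * b.coord q s := by fun_prop
    have hlim := hcont.tendsto 0
    simp only [zero_mul, add_zero] at hlim
    replace hlim := hlim.mono_left (nhdsWithin_le_nhds (s := Set.Ioi (0 : ℝ)))
    rcases lt_trichotomy (b.coord x s) 0 with h | h | h
    · filter_upwards [hlim.eventually (Iio_mem_nhds h)] with ε hε
      have hε' : b.coord x s + ε * b.coord q s < 0 := hε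
      exact ⟨hε'.ne, fun h' => absurd h' hε'.not_gt, fun h' =>
        absurd h' (not_or.2 ⟨h.not_gt, fun h' => h.ne h'.1⟩)⟩
    · filter_upwards [self_mem_nhdsWithin] with ε hε
      have hε' : 0 < ε := hε
      simp [h, hε'.ne', hq b s hs, mul_pos_iff_of_pos_left hε']
    · filter_upwards [hlim.eventually (Ioi_mem_nhds h)] with ε hε
      have hε' : 0 < b.coord x s + ε * b.coord q s := hε
      exact ⟨hε'.ne', fun _ => Or.inl h, fun _ => hε'⟩
  obtain ⟨ε, hε, hpos⟩ := (hev.and self_mem_nhdsWithin).exists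
  exact ⟨ε, hpos, fun b s hs => hε b ⟨s, hs⟩⟩

theorem halfOpenCone_subset_generatedCone (b : SubfamilyBasis v) (J : ι → Prop) :
    b.halfOpenCone J ⊆ generatedCone v := by
  intro x hx
  refine ⟨b.coord x, fun s => ?_, b.sum_coord x⟩
  by_cases hs : s ∈ b.support
  · rcases hx s hs with h | h
    · exact h.le
    · exact h.1.ge
  · exact (b.coord_of_notMem x s hs).ge

theorem exists_generic_heights :
    ∃ ω : ι → ℝ, ∀ b : SubfamilyBasis v, ∀ t ∉ b.support, ∑ s, b.coord (v t) s * ω s ≠ ω t := by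
  obtain ⟨ω, -, hω⟩ := exists_pos_forall_sum_mul_ne_zero
    (κ := Σ b : SubfamilyBasis v, {t // t ∉ b.support})
    (fun j s => j.1.coord (v j.2) s - (Pi.single (j.2 : ι) 1 : ι → ℝ) s) (by
      rintro ⟨b, t, ht⟩ h
      have := congrFun h t
      simp [b.coord_of_notMem _ t ht] at this)
  refine ⟨ω, fun b t ht h => hω ⟨b, t, ht⟩ ?_⟩
  simp [sub_mul, Finset.sum_sub_distrib, h, Pi.single_apply]

theorem exists_generic_point :
    ∃ w : ι → ℝ, (∀ s, 0 < w s) ∧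
      ∀ b : SubfamilyBasis v, ∀ s ∈ b.support, b.coord (∑ t, w t • v t) s ≠ 0 := by
  obtain ⟨w, hw, h⟩ := exists_pos_forall_sum_mul_ne_zero
    (κ := Σ b : SubfamilyBasis v, {t // t ∈ b.support})
    (fun j t => j.1.coord (v t) j.2) (by
      rintro ⟨b, t, ht⟩ h
      have := congrFun h t
      simp [b.coord_self t ht] at this)
  refine ⟨w, hw, fun b s hs h0 => h ⟨b, s, hs⟩ ?_⟩
  simpa [mul_comm] using h0

end Triangulation

variable {ι E : Type*} [Fintype ι] [DecidableEq ι] [NormedAddCommGroup E] [NormedSpace ℝ E]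
  {v : ι → E}

theorem exists_isRegularCell_coord_pos (hspan : Submodule.span ℝ (Set.range v) = ⊤)
    {ht : E →ₗ[ℝ] ℝ} (hv : ∀ s, ht (v s) = 1) {ω : ι → ℝ}
    (hω : ∀ b : SubfamilyBasis v, ∀ t ∉ b.support, ∑ s, b.coord (v t) s * ω s ≠ ω t) {x : E}
    (hx : x ∈ generatedCone v) (hgen : ∀ b : SubfamilyBasis v, ∀ s ∈ b.support, b.coord x s ≠ 0) :
    ∃ b : SubfamilyBasis v, b.IsRegularCell ω ∧ ∀ s ∈ b.support, 0 < b.coord x s := by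
  obtain ⟨w, h0, rfl, hmin⟩ := exists_min_cost hv ω hx
  obtain ⟨b, hb⟩ := exists_adapted hspan {s | 0 < w s}
  have hcost : ∀ t, ∑ s, ((Pi.single t 1 : ι → ℝ) s - b.coord (v t) s) * ω s =
      ω t - ∑ s, b.coord (v t) s * ω s := fun t => by
    simp [sub_mul, Finset.sum_sub_distrib, Pi.single_apply]
  have hsupp : ∀ t ∉ b.support, w t = 0 := by
    intro t ht
    by_contra hwt
    have hwt : 0 < w t := lt_of_le_of_ne (h0 t) (Ne.symm hwt)
    have hpos : ∀ s, (Pi.single t 1 : ι → ℝ) s - b.coord (v t) s ≠ 0 → 0 < w s := by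
      intro s hs
      by_contra hws
      have hst : s ≠ t := fun h => hws (h ▸ hwt)
      by_cases hsb : s ∈ b.support
      · simp [hst, hb t hwt s hsb hws] at hs
      · simp [hst, b.coord_of_notMem _ s hsb] at hs
    have h1 := cost_nonneg_of_feasible_direction h0 hmin (b.sum_sub_coord_smul t)
      fun s hs => hpos s hs.ne
    have h2 := cost_nonneg_of_feasible_direction h0 hmin
      (a := fun s => -((Pi.single t 1 : ι → ℝ) s - b.coord (v t) s))
      (by
        simp only [neg_smul, Finset.sum_neg_distrib, b.sum_sub_coord_smul t, neg_zero])
      fun s hs => hpos s (neg_lt_zero.1 hs).ne'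
    simp only [neg_mul, Finset.sum_neg_distrib] at h2
    rw [hcost] at h1 h2
    exact hω b t ht (by linarith)
  have hcoord := b.coord_sum_smul hsupp
  have hpos : ∀ s ∈ b.support, 0 < w s := fun s hs =>
    lt_of_le_of_ne (h0 s) fun h => hgen b s hs (by rw [hcoord, ← h])
  refine ⟨b, fun t ht => ?_, fun s hs => by rw [hcoord]; exact hpos s hs⟩
  have h1 := cost_nonneg_of_feasible_direction h0 hmin (b.sum_sub_coord_smul t) fun s hs => by
    by_cases hsb : s ∈ b.support
    · exact hpos s hsb
    · rw [b.coord_of_notMem _ s hsb, sub_zero, Pi.single_apply] at hs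
      split_ifs at hs <;> linarith
  rw [hcost] at h1
  exact lt_of_le_of_ne (by linarith) (hω b t ht)

/-- The half-open cells of a regular triangulation partition the cone. -/
theorem existsUnique_halfOpenCone (hspan : Submodule.span ℝ (Set.range v) = ⊤)
    {ht : E →ₗ[ℝ] ℝ} (hv : ∀ s, ht (v s) = 1) {ω : ι → ℝ}
    (hω : ∀ b : SubfamilyBasis v, ∀ t ∉ b.support, ∑ s, b.coord (v t) s * ω s ≠ ω t) {q : E}
    (hq : q ∈ generatedCone v)
    (hgen : ∀ b : SubfamilyBasis v, ∀ s ∈ b.support, b.coord q s ≠ 0) {x : E}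
    (hx : x ∈ generatedCone v) :
    ∃! b : SubfamilyBasis v, b.IsRegularCell ω ∧ x ∈ b.halfOpenCone fun s => 0 < b.coord q s := by
  obtain ⟨ε, hε, h⟩ := exists_pos_forall_coord_add_smul hgen x
  have hmem : ∀ b : SubfamilyBasis v, (x ∈ b.halfOpenCone fun s => 0 < b.coord q s) ↔
      ∀ s ∈ b.support, 0 < b.coord (x + ε • q) s := fun b =>
    forall₂_congr fun s hs => (h b s hs).2.symm
  have hxq : x + ε • q ∈ generatedCone v := by
    obtain ⟨w, hw, rfl⟩ := hx
    obtain ⟨w', hw', rfl⟩ := hq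
    refine ⟨fun s => w s + ε * w' s,
      fun s => add_nonneg (hw s) (mul_nonneg hε.le (hw' s)), ?_⟩
    simp [add_smul, mul_smul, Finset.sum_add_distrib, Finset.smul_sum]
  obtain ⟨b, hb, hbx⟩ :=
    exists_isRegularCell_coord_pos hspan hv hω hxq fun b s hs => (h b s hs).1
  refine ⟨b, ⟨hb, (hmem b).2 hbx⟩, ?_⟩
  rintro b' ⟨hb', hbx'⟩
  exact hb'.eq_of_coord_pos hb ((hmem b').1 hbx') hbx

end SubfamilyBasis

/-- Lattice points of a cone over a lattice polytope, counted by height. -/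
theorem hasNonnegHStar_generatedCone {ι E : Type*} [Fintype ι] [Nonempty ι]
    [NormedAddCommGroup E] [NormedSpace ℝ E] {v : ι → E}
    (hspan : Submodule.span ℝ (Set.range v) = ⊤) {d : ℕ} (hd : Module.finrank ℝ E = d + 1)
    {ht : E →ₗ[ℝ] ℝ} (hv : ∀ s, ht (v s) = 1)
    {L : AddSubgroup E} (hvL : ∀ s, v s ∈ L) (hint : ∀ x ∈ L, ∃ z : ℤ, ht x = z)
    (hfin : ∀ k : ℕ, {x | x ∈ L ∧ x ∈ generatedCone v ∧ ht x = k}.Finite) :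
    HasNonnegHStar d fun k => {x | x ∈ L ∧ x ∈ generatedCone v ∧ ht x = k}.ncard := by
  classical
  obtain ⟨ω, hω⟩ := SubfamilyBasis.exists_generic_heights (v := v)
  obtain ⟨w, hw, hq⟩ := SubfamilyBasis.exists_generic_point (v := v)
  set q := ∑ t, w t • v t with hqdef
  have hqC : q ∈ generatedCone v := ⟨w, fun s => (hw s).le, rfl⟩
  have hqht : 0 < ht q := by
    have : ht q = ∑ s, w s := by simp [hqdef, hv]
    rw [this]
    exact Finset.sum_pos (fun s _ => hw s) Finset.univ_nonempty
  have hpart := fun (x : E) (hx : x ∈ generatedCone v) =>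
    SubfamilyBasis.existsUnique_halfOpenCone hspan hv hω hqC hq hx
  let C : SubfamilyBasis v → Set E := fun b => b.halfOpenCone fun s => 0 < b.coord q s
  have hC : ∀ b k, {x | x ∈ L ∧ x ∈ C b ∧ ht x = k} ⊆
      {x | x ∈ L ∧ x ∈ generatedCone v ∧ ht x = k} :=
    fun b k x hx => ⟨hx.1, b.halfOpenCone_subset_generatedCone _ hx.2.1, hx.2.2⟩
  let T : Finset (SubfamilyBasis v) := (Set.toFinite {b | b.IsRegularCell ω}).toFinset
  have hcount : ∀ k : ℕ, {x | x ∈ L ∧ x ∈ generatedCone v ∧ ht x = k}.ncard =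
      ∑ b ∈ T, {x | x ∈ L ∧ x ∈ C b ∧ ht x = k}.ncard := by
    intro k
    have hunion : {x | x ∈ L ∧ x ∈ generatedCone v ∧ ht x = k} =
        ⋃ b ∈ T, {x | x ∈ L ∧ x ∈ C b ∧ ht x = k} := by
      refine Set.Subset.antisymm (fun x hx => ?_) (Set.iUnion₂_subset fun b _ => hC b k)
      obtain ⟨b, ⟨hb, hxb⟩, -⟩ := hpart x hx.2.1
      exact Set.mem_iUnion₂.2 ⟨b, by simpa [T] using hb, hx.1, hxb, hx.2.2⟩
    rw [hunion, ← finsum_mem_coe_finset]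
    refine T.finite_toSet.ncard_biUnion (fun b _ => (hfin k).subset (hC b k)) ?_
    · intro b hb b' hb' hne
      refine Set.disjoint_left.2 fun x hx hx' => hne ?_
      exact (hpart x (hC b k hx).2.1).unique ⟨by simpa [T] using hb, hx.2.1⟩
        ⟨by simpa [T] using hb', hx'.2.1⟩
  simp only [hcount]
  refine HasNonnegHStar.sum fun b _ => b.hasNonnegHStar_halfOpenCone (b.card_support.trans hd) hv
    ?_ hvL hint fun k => (hfin k).subset (hC b k)
  by_contra! hneg
  rw [b.height_eq_sum_coord hv] at hqht
  exact hqht.not_ge (Finset.sum_nonpos hneg)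

/-- Homogenization raises the dimension by one. -/
theorem finrank_span_range_prodMk_one {ι V : Type*} [AddCommGroup V] [Module ℝ V]
    [FiniteDimensional ℝ V] [Nonempty ι] (p : ι → V) :
    Module.finrank ℝ (Submodule.span ℝ (Set.range fun i => (p i, (1 : ℝ)))) =
      Module.finrank ℝ (vectorSpan ℝ (Set.range p)) + 1 := by
  obtain ⟨i₀⟩ := ‹Nonempty ι›
  let D := vectorSpan ℝ (Set.range p)
  let F : D × ℝ →ₗ[ℝ] V × ℝ :=
    (D.subtype.comp (LinearMap.fst ℝ D ℝ) +
      (LinearMap.toSpanSingleton ℝ V (p i₀)).comp (LinearMap.snd ℝ D ℝ)).prod (LinearMap.snd ℝ D ℝ)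
  have hF : ∀ δ r, F (δ, r) = ((δ : V) + r • p i₀, r) := fun δ r => by simp [F]
  have hinj : Function.Injective F := by
    rintro ⟨δ, r⟩ ⟨δ', r'⟩ h
    rw [hF, hF, Prod.mk.injEq] at h
    obtain ⟨h, rfl⟩ := h
    rw [add_left_inj] at h
    rw [Subtype.ext h]
  have hrange : Submodule.span ℝ (Set.range fun i => (p i, (1 : ℝ))) = LinearMap.range F := by
    refine le_antisymm (Submodule.span_le.2 ?_) ?_
    · rintro _ ⟨i, rfl⟩
      refine ⟨(⟨p i - p i₀, vsub_mem_vectorSpan ℝ ⟨i, rfl⟩ ⟨i₀, rfl⟩⟩, 1), ?_⟩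
      simp [hF]
    · rintro _ ⟨⟨δ, r⟩, rfl⟩
      have hδ : ((δ : V), (0 : ℝ)) ∈ Submodule.span ℝ (Set.range fun i => (p i, (1 : ℝ))) := by
        have hle : D ≤ (Submodule.span ℝ (Set.range fun i => (p i, (1 : ℝ)))).comap
            (LinearMap.inl ℝ V ℝ) := by
          change vectorSpan ℝ (Set.range p) ≤ _
          rw [vectorSpan_range_eq_span_range_vsub_right ℝ p i₀, Submodule.span_le]
          rintro _ ⟨i, rfl⟩
          have := Submodule.sub_mem _
            (Submodule.subset_span (R := ℝ) (s := Set.range fun i => (p i, (1 : ℝ))) ⟨i, rfl⟩)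
            (Submodule.subset_span (R := ℝ) (s := Set.range fun i => (p i, (1 : ℝ))) ⟨i₀, rfl⟩)
          simpa using this
        exact hle δ.2
      have hr := Submodule.smul_mem _ r
        (Submodule.subset_span (R := ℝ) (s := Set.range fun i => (p i, (1 : ℝ))) ⟨i₀, rfl⟩)
      have := Submodule.add_mem _ hδ hr
      rw [hF]
      simpa using this
  rw [hrange, LinearMap.finrank_range_of_inj hinj, Module.finrank_prod, Module.finrank_self]

theorem mem_smul_convexHull_range_iff {ι V : Type*} [Fintype ι] [AddCommGroup V] [Module ℝ V]
    (p : ι → V) {k : ℝ} (hk : 0 < k) (x : V) :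
    x ∈ k • convexHull ℝ (Set.range p) ↔
      (x, k) ∈ generatedCone fun i => (p i, (1 : ℝ)) := by
  have hhull : ∀ y, y ∈ convexHull ℝ (Set.range p) ↔
      ∃ w : ι → ℝ, (∀ i, 0 ≤ w i) ∧ ∑ i, w i = 1 ∧ ∑ i, w i • p i = y := by
    intro y
    classical
    have hrange : Set.range p =
        Fintype.linearCombination ℝ p '' Set.range fun i : ι => Pi.single i (1 : ℝ) := by
      rw [← Set.range_comp]
      congr 1
      ext i
      simp
    rw [hrange, ← LinearMap.image_convexHull, convexHull_rangle_single_eq_stdSimplex]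
    exact exists_congr fun w => and_assoc
  constructor
  · rintro ⟨y, hy, rfl⟩
    obtain ⟨w, hw, h1, rfl⟩ := (hhull y).1 hy
    refine ⟨fun i => k * w i, fun i => mul_nonneg hk.le (hw i), ?_⟩
    ext1
    · simp [Prod.fst_sum, Finset.smul_sum, mul_smul]
    · simp [Prod.snd_sum, ← Finset.mul_sum, h1]
  · rintro ⟨w, hw, h⟩
    have hx : ∑ i, w i • p i = x := by simpa [Prod.fst_sum] using congrArg Prod.fst h
    have h1 : ∑ i, w i = k := by simpa [Prod.snd_sum] using congrArg Prod.snd h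
    rw [Set.mem_smul_set_iff_inv_smul_mem₀ hk.ne', hhull]
    refine ⟨fun i => k⁻¹ * w i, fun i => mul_nonneg (inv_nonneg.2 hk.le) (hw i), ?_, ?_⟩
    · rw [← Finset.mul_sum, h1, inv_mul_cancel₀ hk.ne']
    · simp [← hx, Finset.smul_sum, mul_smul]

theorem mem_generatedCone_coe_iff {ι E : Type*} [Fintype ι] [AddCommGroup E] [Module ℝ E]
    (W : Submodule ℝ E) (v : ι → W) (x : W) :
    x ∈ generatedCone v ↔ (x : E) ∈ generatedCone fun i => (v i : E) := by
  refine exists_congr fun w => and_congr_right fun _ => ?_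
  rw [Subtype.ext_iff]
  simp

theorem finite_setOf_intCast_mem_generatedCone {ι : Type*} [Fintype ι] {n : ℕ}
    (p : ι → Fin n → ℤ) (k : ℕ) :
    {x : Fin n → ℤ | ((fun i => (x i : ℝ)), (k : ℝ)) ∈
      generatedCone fun s => ((fun i => (p s i : ℝ)), (1 : ℝ))}.Finite := by
  let R : ℤ := ∑ s, ∑ j, |p s j|
  refine (Set.finite_Icc (fun _ : Fin n => -(k * R)) (fun _ => k * R)).subset ?_
  rintro x ⟨w, hw, h⟩
  have hx : ∀ i, ∑ s, w s * (p s i : ℝ) = x i := fun i => by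
    simpa [Prod.fst_sum] using congrFun (congrArg Prod.fst h) i
  have hk : ∑ s, w s = k := by simpa [Prod.snd_sum] using congrArg Prod.snd h
  have hR : ∀ s i, |p s i| ≤ R := fun s i =>
    (Finset.single_le_sum (f := fun j => |p s j|) (fun _ _ => abs_nonneg _)
      (Finset.mem_univ i)).trans
    (Finset.single_le_sum (f := fun s => ∑ j, |p s j|)
      (fun _ _ => Finset.sum_nonneg fun _ _ => abs_nonneg _) (Finset.mem_univ s))
  have habs : ∀ i, |x i| ≤ k * R := by
    intro i
    have : |(x i : ℝ)| ≤ k * R := by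
      rw [← hx i, ← hk, Finset.sum_mul]
      refine (Finset.abs_sum_le_sum_abs _ _).trans (Finset.sum_le_sum fun s _ => ?_)
      rw [abs_mul, abs_of_nonneg (hw s)]
      exact mul_le_mul_of_nonneg_left (by exact_mod_cast hR s i) (hw s)
    exact_mod_cast this
  exact ⟨fun i => (abs_le.1 (habs i)).1, fun i => (abs_le.1 (habs i)).2⟩

/-- Integer points at height `k` of the homogenized cone are counted by a polynomial with
nonnegative `h*`-vector. -/
theorem hasNonnegHStar_intCast {ι : Type*} [Fintype ι] [Nonempty ι] {n d : ℕ}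
    (p : ι → Fin n → ℤ)
    (hd : d = Module.finrank ℝ (vectorSpan ℝ (Set.range fun s => fun i => (p s i : ℝ)))) :
    HasNonnegHStar d fun k => {x : Fin n → ℤ | ((fun i => (x i : ℝ)), (k : ℝ)) ∈
      generatedCone fun s => ((fun i => (p s i : ℝ)), (1 : ℝ))}.ncard := by
  let f : ι → (Fin n → ℝ) × ℝ := fun s => ((fun i => (p s i : ℝ)), (1 : ℝ))
  let W : Submodule ℝ ((Fin n → ℝ) × ℝ) := Submodule.span ℝ (Set.range f)
  let v : ι → W := fun s => ⟨f s, Submodule.subset_span ⟨s, rfl⟩⟩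
  have hspan : Submodule.span ℝ (Set.range v) = ⊤ := by
    have := Submodule.span_span_coe_preimage (R := ℝ) (s := Set.range f)
    convert this using 2
    ext x
    simp [v, Subtype.ext_iff]
  let M : AddSubgroup ((Fin n → ℝ) × ℝ) :=
    (((Int.castAddHom ℝ).compLeft (Fin n)).prodMap (Int.castAddHom ℝ)).range
  have hM : ∀ y, y ∈ M ↔ ∃ (x : Fin n → ℤ) (z : ℤ), ((fun i => (x i : ℝ)), (z : ℝ)) = y :=
    fun y => Prod.exists
  let ht : W →ₗ[ℝ] ℝ := (LinearMap.snd ℝ (Fin n → ℝ) ℝ).comp W.subtype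
  let c : ℕ → (Fin n → ℤ) → (Fin n → ℝ) × ℝ := fun k x => ((fun i => (x i : ℝ)), (k : ℝ))
  have hc : ∀ k, Function.Injective (c k) := by
    intro k x y h
    ext i
    exact Int.cast_injective (congrFun (congrArg Prod.fst h) i)
  have himage : ∀ k : ℕ, Subtype.val ''
      {y : W | y ∈ M.comap W.subtype.toAddMonoidHom ∧ y ∈ generatedCone v ∧ ht y = k} =
      c k '' {x | c k x ∈ generatedCone f} := by
    intro k
    ext y
    constructor
    · rintro ⟨y, ⟨hyM, hy, hk⟩, rfl⟩
      obtain ⟨x, z, hxz⟩ := (hM _).1 hyM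
      have hcx : c k x = y := by
        change (y : (Fin n → ℝ) × ℝ).2 = k at hk
        change _ = (y : (Fin n → ℝ) × ℝ) at hxz
        rw [← hxz] at hk ⊢
        exact Prod.ext rfl hk.symm
      exact ⟨x, by rw [Set.mem_ofPred_eq, hcx]; exact (mem_generatedCone_coe_iff W v y).1 hy, hcx⟩
    · rintro ⟨x, hx, rfl⟩
      have hW : c k x ∈ W := by
        obtain ⟨w, -, h⟩ := hx
        rw [← h]
        exact Submodule.sum_mem _ fun s _ =>
          Submodule.smul_mem _ _ (Submodule.subset_span ⟨s, rfl⟩)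
      exact ⟨⟨c k x, hW⟩, ⟨(hM _).2 ⟨x, k, by simp [c]⟩,
        (mem_generatedCone_coe_iff W v _).2 hx, rfl⟩, rfl⟩
  have hcone := hasNonnegHStar_generatedCone (v := v) hspan (d := d) (ht := ht)
    (by rw [hd]; exact finrank_span_range_prodMk_one _) (fun s => rfl)
    (L := M.comap W.subtype.toAddMonoidHom) (fun s => (hM _).2 ⟨p s, 1, by simp [v, f]⟩)
    (by
      intro y hy
      obtain ⟨x, z, hxz⟩ := (hM _).1 hy
      exact ⟨z, (congrArg Prod.snd hxz).symm⟩)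
    (by
      intro k
      refine Set.Finite.of_finite_image ?_ (Subtype.val_injective.injOn)
      rw [himage]
      exact (finite_setOf_intCast_mem_generatedCone p k).image _)
  convert hcone using 2 with k
  rw [← Set.ncard_image_of_injective _ (hc k),
    ← Set.ncard_image_of_injective _ Subtype.val_injective,
    himage]

/-- Stanley's nonnegativity theorem: the Ehrhart polynomial of an integral polytope of
dimension `d` has a nonnegative `h*`-vector, i.e. the number of integer points in the `k`-th
dilate is `Σ_{i=0}^{d} h*_i · C(k + d - i, d)` with nonnegative integers `h*_i`. -/
theorem stanley_nonnegativity
    (n : ℕ) (S : Finset (Fin n → ℤ)) (hS : S.Nonempty)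
    (P : Set (Fin n → ℝ))
    (hP : P = convexHull ℝ ((fun y : Fin n → ℤ => fun i => (y i : ℝ)) '' ↑S))
    (d : ℕ) (hd : d = Module.finrank ℝ (affineSpan ℝ P).direction) :
    ∃ h : Fin (d + 1) → ℕ,
      ∀ k : ℕ, 0 < k →
        Set.ncard {x : Fin n → ℤ | (fun i => (x i : ℝ)) ∈ (k : ℝ) • P} =
          ∑ i : Fin (d + 1), h i * Nat.choose (k + d - (i : ℕ)) d := by
  have := hS.to_subtype
  have himage : (fun y : Fin n → ℤ => fun i => (y i : ℝ)) '' ↑S =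
      Set.range fun (s : S) (i : Fin n) => ((s : Fin n → ℤ) i : ℝ) := by
    rw [Set.image_eq_range]
    rfl
  rw [himage] at hP
  rw [hP, affineSpan_convexHull, direction_affineSpan] at hd
  obtain ⟨h, hh⟩ := hasNonnegHStar_intCast (fun s : S => (s : Fin n → ℤ)) hd
  refine ⟨h, fun k hk => ?_⟩
  rw [← hh k, hP]
  congr 1
  ext x
  exact mem_smul_convexHull_range_iff _ (Nat.cast_pos.2 hk) _
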